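/- With the standing setup, for each 1 ≤ i ≤ m the permutation v_i is the maximum element of the block [u,v]^{(i)} in the Bruhat order; that is, v_i ∈ [u,v]^{(i)} and w ≤ v_i for all w ∈ [u,v]^{(i)}. -/

import Mathlib

open Equiv Finset Polynomial

/-- The odd diagram of a permutation of `Fin n` (0-based positions and values):
boxes `(i, j)` with `w i > j`, `i < w⁻¹ j`, and `i`, `w⁻¹ j` of different parity. -/
def oddDiagram {n : ℕ} (w : Equiv.Perm (Fin n)) : Set (Fin n × Fin n) :=
  {p | p.2 < w p.1 ∧ p.1 < w⁻¹ p.2 ∧ ((p.1 : ℕ) % 2 ≠ ((w⁻¹ p.2 : Fin n) : ℕ) % 2)}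

/-- The Bruhat order on `S_n`: the reflexive-transitive closure of the relations
`x < x * (i j)` whenever `i < j` and `x i < x j`. -/
def bruhatLE {n : ℕ} : Equiv.Perm (Fin n) → Equiv.Perm (Fin n) → Prop :=
  Relation.ReflTransGen (fun x y => ∃ i j : Fin n, i < j ∧ x i < x j ∧ y = x * Equiv.swap i j)

/-- Strict Bruhat order. -/
def bruhatLT {n : ℕ} (x y : Equiv.Perm (Fin n)) : Prop := bruhatLE x y ∧ x ≠ y

/-- The Coxeter length of a permutation, i.e. its number of inversions. -/
def invLength {n : ℕ} (w : Equiv.Perm (Fin n)) : ℕ :=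
  (Finset.univ.filter (fun p : Fin n × Fin n => p.1 < p.2 ∧ w p.2 < w p.1)).card

theorem perm_apply_inv_self {α : Type*} (f : Equiv.Perm α) (x : α) : f (f⁻¹ x) = x :=
  f.apply_symm_apply x

theorem perm_inv_apply_self {α : Type*} (f : Equiv.Perm α) (x : α) : f⁻¹ (f x) = x :=
  f.symm_apply_apply x

/-- The number of positions below `P` whose value under `w` is at least `Q`. -/
def rankCount {n : ℕ} (w : Equiv.Perm (Fin n)) (P Q : ℕ) : ℕ :=
  ∑ t : Fin n, if (t : ℕ) < P ∧ Q ≤ (w t : ℕ) then 1 else 0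

theorem rankCount_mul_swap {n : ℕ} (x : Equiv.Perm (Fin n)) {p q : Fin n} (hpq : p < q)
    (hx : x p < x q) (P Q : ℕ) :
    rankCount (x * Equiv.swap p q) P Q = rankCount x P Q +
      if (p : ℕ) < P ∧ P ≤ q ∧ (x p : ℕ) < Q ∧ Q ≤ x q then 1 else 0 := by
  have hq : q ∈ (Finset.univ : Finset (Fin n)).erase p := by simp [hpq.ne']
  unfold rankCount
  rw [← Finset.add_sum_erase _ _ (Finset.mem_univ p), ← Finset.add_sum_erase _ _ hq,
    ← Finset.add_sum_erase (Finset.univ : Finset (Fin n))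
      (fun t : Fin n => if (t : ℕ) < P ∧ Q ≤ (x t : ℕ) then 1 else 0) (Finset.mem_univ p),
    ← Finset.add_sum_erase _ (fun t : Fin n => if (t : ℕ) < P ∧ Q ≤ (x t : ℕ) then 1 else 0) hq]
  have hrest : ∀ t ∈ ((Finset.univ : Finset (Fin n)).erase p).erase q,
      (if (t : ℕ) < P ∧ Q ≤ ((x * Equiv.swap p q) t : ℕ) then 1 else 0) =
        if (t : ℕ) < P ∧ Q ≤ (x t : ℕ) then 1 else 0 := by
    intro t ht
    simp only [Finset.mem_erase] at ht
    rw [Equiv.Perm.mul_apply, Equiv.swap_apply_of_ne_of_ne ht.2.1 ht.1]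
  rw [Finset.sum_congr rfl hrest]
  simp only [Equiv.Perm.mul_apply, Equiv.swap_apply_left, Equiv.swap_apply_right]
  rw [Fin.lt_def] at hpq hx
  split_ifs <;> omega

theorem rankCount_le_of_bruhatLE {n : ℕ} {x y : Equiv.Perm (Fin n)} (h : bruhatLE x y)
    (P Q : ℕ) : rankCount x P Q ≤ rankCount y P Q := by
  induction h with
  | refl => exact le_rfl
  | tail _ hs ih =>
    obtain ⟨i, j, hij, hlt, rfl⟩ := hs
    rw [rankCount_mul_swap _ hij hlt]
    omega

/-- If `y` dominates `x` before position `A`, at every position from `A` to `P`, and strictly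
at `A`, then the rank counts up to `P` differ strictly. -/
theorem rankCount_lt_of_tail {n : ℕ} {x y : Equiv.Perm (Fin n)} {A : Fin n} {P Q : ℕ}
    (hAP : (A : ℕ) < P) (hle : rankCount x A Q ≤ rankCount y A Q)
    (htail : ∀ t : Fin n, A ≤ t → (t : ℕ) < P → Q ≤ x t → Q ≤ y t)
    (hx : (x A : ℕ) < Q) (hy : Q ≤ (y A : ℕ)) :
    rankCount x P Q < rankCount y P Q := by
  have split : ∀ w : Equiv.Perm (Fin n), rankCount w P Q = rankCount w A Q +
      ∑ t : Fin n, if A ≤ t ∧ (t : ℕ) < P ∧ Q ≤ (w t : ℕ) then 1 else 0 := by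
    intro w
    unfold rankCount
    rw [← Finset.sum_add_distrib]
    refine Finset.sum_congr rfl fun t _ => ?_
    simp only [Fin.le_def]
    split_ifs <;> omega
  rw [split x, split y]
  refine add_lt_add_of_le_of_lt hle (Finset.sum_lt_sum (fun t _ => ?_) ⟨A, Finset.mem_univ A, ?_⟩)
  · have := htail t
    split_ifs <;> omega
  · rw [if_neg (by omega), if_pos ⟨le_rfl, hAP, hy⟩]
    exact Nat.one_pos

theorem not_bruhatLE_of_swap {n : ℕ} {x : Equiv.Perm (Fin n)} {p q : Fin n} (hpq : p < q)
    (hx : x p < x q) : ¬ bruhatLE (x * Equiv.swap p q) x := by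
  intro h
  have h1 := rankCount_le_of_bruhatLE h q (x q)
  rw [rankCount_mul_swap x hpq hx, if_pos ⟨hpq, le_rfl, hx, le_rfl⟩] at h1
  omega

/-- If `x ≠ y` and `x` is dominated by `y`, some swap raises `x` while staying dominated. -/
theorem exists_swap_rankCount_le {n : ℕ} {x y : Equiv.Perm (Fin n)} (hxy : x ≠ y)
    (h : ∀ P Q, rankCount x P Q ≤ rankCount y P Q) :
    ∃ p q : Fin n, p < q ∧ x p < x q ∧
      ∀ P Q, rankCount (x * Equiv.swap p q) P Q ≤ rankCount y P Q := by
  have hex : ∃ t, x t ≠ y t := by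
    by_contra! hc
    exact hxy (Equiv.ext hc)
  obtain ⟨a, ha, hamin⟩ :=
    WellFounded.has_min (wellFounded_lt (α := Fin n)) {t | x t ≠ y t} hex
  have heq : ∀ t < a, x t = y t := fun t ht => by
    by_contra hc
    exact hamin t hc ht
  have hprefix : ∀ Q, rankCount x a Q = rankCount y a Q := by
    intro Q
    refine Finset.sum_congr rfl fun t _ => ?_
    by_cases ht : t < a
    · rw [heq t ht]
    · rw [if_neg (fun hc => ht hc.1), if_neg (fun hc => ht hc.1)]
  have halt : x a < y a := by
    by_contra hc
    have hlt : y a < x a := lt_of_le_of_ne (not_lt.1 hc) (Ne.symm ha)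
    have := h (a + 1) (x a)
    refine absurd this (not_le.2 ?_)
    refine rankCount_lt_of_tail (A := a) (Nat.lt_succ_self _) (hprefix _).ge ?_ hlt le_rfl
    intro t h1 h2 h3
    obtain rfl : t = a := le_antisymm (Fin.le_def.2 (by omega)) h1
    exact le_rfl
  have hbex : ∃ t, a < t ∧ x a < x t ∧ x t ≤ y a := by
    refine ⟨x⁻¹ (y a), ?_, by simpa using halt, by simp⟩
    by_contra hc
    rcases lt_or_eq_of_le (not_lt.1 hc) with h1 | h1
    · have h2 := heq _ h1
      rw [perm_apply_inv_self] at h2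
      exact h1.ne (y.injective h2).symm
    · rw [← h1, perm_apply_inv_self, h1] at halt
      exact lt_irrefl _ halt
  obtain ⟨b, ⟨hab, hxab, hxb⟩, hbmin⟩ := WellFounded.has_min (wellFounded_lt (α := Fin n))
    {t | a < t ∧ x a < x t ∧ x t ≤ y a} hbex
  refine ⟨a, b, hab, hxab, fun P Q => ?_⟩
  rw [rankCount_mul_swap x hab hxab]
  split_ifs with hc
  swap
  · exact h P Q
  obtain ⟨h1, h2, h3, h4⟩ := hc
  have hband : ∀ w : Equiv.Perm (Fin n), rankCount w P Q = rankCount w P (y a + 1) +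
      ∑ t : Fin n, if (t : ℕ) < P ∧ Q ≤ (w t : ℕ) ∧ w t ≤ y a then 1 else 0 := by
    intro w
    unfold rankCount
    rw [← Finset.sum_add_distrib]
    refine Finset.sum_congr rfl fun t _ => ?_
    rw [Fin.le_def] at *
    split_ifs <;> omega
  have hlt : (∑ t : Fin n, if (t : ℕ) < P ∧ Q ≤ (x t : ℕ) ∧ x t ≤ y a then 1 else 0) <
      ∑ t : Fin n, if (t : ℕ) < P ∧ Q ≤ (y t : ℕ) ∧ y t ≤ y a then 1 else 0 := by
    refine Finset.sum_lt_sum (fun t _ => ?_) ⟨a, Finset.mem_univ a, ?_⟩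
    · rcases lt_trichotomy t a with ht | rfl | ht
      · rw [heq t ht]
      · rw [if_neg (by omega)]
        exact Nat.zero_le _
      · rw [if_neg]
        · exact Nat.zero_le _
        · rintro ⟨g1, g2, g3⟩
          exact hbmin t ⟨ht, Fin.lt_def.2 (by omega), g3⟩ (Fin.lt_def.2 (by omega))
    · rw [if_neg (by omega), if_pos ⟨h1, by rw [Fin.le_def] at hxb; omega, le_rfl⟩]
      exact Nat.one_pos
  have := h P (y a + 1)
  rw [hband x, hband y]
  omega

/-- The tableau-type criterion for the Bruhat order. -/
theorem bruhatLE_of_rankCount_le {n : ℕ} {x y : Equiv.Perm (Fin n)}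
    (h : ∀ P Q, rankCount x P Q ≤ rankCount y P Q) : bruhatLE x y := by
  let S : Equiv.Perm (Fin n) → ℕ :=
    fun w => ∑ P ∈ Finset.range (n + 1), ∑ Q ∈ Finset.range (n + 1), rankCount w P Q
  induction hd : S y - S x using Nat.strong_induction_on generalizing x with
  | _ d ih =>
    by_cases hxy : x = y
    · rw [hxy]
      exact Relation.ReflTransGen.refl
    obtain ⟨p, q, hpq, hlt, hle⟩ := exists_swap_rankCount_le hxy h
    have hup : S x < S (x * Equiv.swap p q) := by
      have hle' : ∀ P Q, rankCount x P Q ≤ rankCount (x * Equiv.swap p q) P Q := fun P Q => by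
        rw [rankCount_mul_swap x hpq hlt]
        omega
      refine Finset.sum_lt_sum (fun P _ => Finset.sum_le_sum fun Q _ => hle' P Q)
        ⟨q, Finset.mem_range.2 (by omega), ?_⟩
      refine Finset.sum_lt_sum (fun Q _ => hle' q Q) ⟨x q, Finset.mem_range.2 (by omega), ?_⟩
      rw [rankCount_mul_swap x hpq hlt, if_pos ⟨hpq, le_rfl, hlt, le_rfl⟩]
      exact Nat.lt_succ_self _
    have hbd : S (x * Equiv.swap p q) ≤ S y :=
      Finset.sum_le_sum fun P _ => Finset.sum_le_sum fun Q _ => hle P Q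
    exact Relation.ReflTransGen.head ⟨p, q, hpq, hlt, rfl⟩ (ih _ (by omega) hle rfl)

/-- Going up in Bruhat order moves the first displaced value to the right. -/
theorem inv_apply_le_of_bruhatLE {n : ℕ} {x y : Equiv.Perm (Fin n)} (h : bruhatLE x y)
    {k : Fin n} (hk : ∀ i < k, x⁻¹ i = y⁻¹ i) : x⁻¹ k ≤ y⁻¹ k := by
  by_contra! hc
  have hge : ∀ t, k < y t → k ≤ x t := by
    intro t ht
    by_contra! hlt
    have := hk _ hlt
    rw [perm_inv_apply_self, eq_comm, Equiv.Perm.inv_eq_iff_eq] at this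
    rw [← this] at ht
    exact lt_asymm hlt ht
  have hne : ∀ t, t ≤ y⁻¹ k → k ≠ x t := by
    rintro t ht rfl
    rw [perm_inv_apply_self] at hc
    exact absurd ht (not_le.2 hc)
  have hge' : k ≤ x (y⁻¹ k) := by
    by_contra! hlt
    have := hk _ hlt
    rw [perm_inv_apply_self] at this
    rw [y⁻¹.injective this.symm] at hlt
    exact lt_irrefl _ hlt
  have := rankCount_le_of_bruhatLE h (y⁻¹ k + 1) (k + 1)
  refine absurd this (not_le.2 ?_)
  refine Finset.sum_lt_sum (fun t _ => ?_) ⟨y⁻¹ k, Finset.mem_univ _, ?_⟩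
  · by_cases ht : (t : ℕ) < (y⁻¹ k : Fin n) + 1 ∧ (k : ℕ) + 1 ≤ y t
    · have h1 := hge t (Fin.lt_def.2 (by omega))
      have h2 := hne t (Fin.le_def.2 (by omega))
      have h3 := Fin.lt_def.1 (lt_of_le_of_ne h1 h2)
      rw [if_pos ht, if_pos ⟨ht.1, h3⟩]
    · rw [if_neg ht]
      exact Nat.zero_le _
  · have h3 := Fin.lt_def.1 (lt_of_le_of_ne hge' (hne _ le_rfl))
    rw [if_neg (by simp), if_pos ⟨Nat.lt_succ_self _, h3⟩]
    exact Nat.one_pos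

/-- Membership of a box in the odd diagram, in terms of two positions. -/
theorem mem_oddDiagram_apply {n : ℕ} (w : Equiv.Perm (Fin n)) (i s : Fin n) :
    (i, w s) ∈ oddDiagram w ↔ w s < w i ∧ i < s ∧ (i : ℕ) % 2 ≠ (s : ℕ) % 2 := by
  simp [oddDiagram]

theorem oddDiagram_mul_swap {n : ℕ} (x : Equiv.Perm (Fin n)) {p q : Fin n} (hpq : p < q)
    (hpar : (p : ℕ) % 2 = (q : ℕ) % 2)
    (hmid : ∀ t, p < t → t < q → (t : ℕ) % 2 ≠ (p : ℕ) % 2 → x t < x p ∧ x t < x q)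
    (hright : ∀ t, q < t → (t : ℕ) % 2 ≠ (p : ℕ) % 2 → (x t < x p ↔ x t < x q)) :
    oddDiagram (x * Equiv.swap p q) = oddDiagram x := by
  ext ⟨i, j⟩
  obtain ⟨s, rfl⟩ := x.surjective j
  rw [mem_oddDiagram_apply]
  have hs : x s = (x * Equiv.swap p q) (Equiv.swap p q s) := by simp
  rw [hs, mem_oddDiagram_apply, ← hs, Equiv.Perm.mul_apply]
  have hL := Equiv.swap_apply_left p q
  have hR := Equiv.swap_apply_right p q
  have hO : ∀ t, t ≠ p → t ≠ q → Equiv.swap p q t = t :=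
    fun t => Equiv.swap_apply_of_ne_of_ne
  have hmi := hmid i
  have hms := hmid s
  have hrs := hright s
  clear hs hmid hright
  by_cases hip : i = p <;> by_cases hiq : i = q <;> by_cases hsp : s = p <;>
    by_cases hsq : s = q <;> grind

/-- Lowering `x` by a swap that moves the value `k` left keeps it above `w`, provided that
at each position between that of `k` in `w` and `q` either `w` is below `k` or `x` is at least
`x p`. -/
theorem bruhatLE_mul_swap_of_bruhatLE {n : ℕ} {w x : Equiv.Perm (Fin n)} (h : bruhatLE w x)
    {p q k : Fin n} (hpq : p < q) (hq : x q = k) (hkp : k < x p) (hwp : w⁻¹ k ≤ p)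
    (hbig : ∀ t, w⁻¹ k ≤ t → t < q → w t < k ∨ x p ≤ x t) :
    bruhatLE w (x * Equiv.swap p q) := by
  refine bruhatLE_of_rankCount_le fun P Q => ?_
  have hle := rankCount_le_of_bruhatLE h
  have hyp : (x * Equiv.swap p q) p = k := by simp [hq]
  have hyq : (x * Equiv.swap p q) q = x p := by simp
  have hx := rankCount_mul_swap (x * Equiv.swap p q) hpq (by rw [hyp, hyq]; exact hkp) P Q
  rw [mul_assoc, Equiv.swap_mul_self, mul_one, hyp, hyq] at hx
  have := hle P Q
  split_ifs at hx with hc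
  · obtain ⟨h1, h2, h3, h4⟩ := hc
    have hlt : rankCount w P Q < rankCount x P Q := by
      refine rankCount_lt_of_tail (A := w⁻¹ k) ?_ (hle _ _) ?_ (by simpa using h3) ?_
      · rw [Fin.le_def] at hwp
        omega
      · intro t g1 g2 g3
        rcases hbig t g1 (Fin.lt_def.2 (by omega)) with g | g
        · rw [Fin.lt_def] at g
          omega
        · exact h4.trans g
      · rcases hbig _ le_rfl (lt_of_le_of_lt hwp hpq) with g | g
        · simp at g
        · exact h4.trans g
    omega
  · omega

/-- With the standing setup, `vᵢ` is the maximum element of the block `[u,v]⁽ⁱ⁾`. -/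
theorem vi_is_max_of_block {n : ℕ} (D : Set (Fin n × Fin n)) (u v : Equiv.Perm (Fin n))
    (hu : oddDiagram u = D) (hv : oddDiagram v = D) (hne : u ≠ v)
    (hint : ∀ w : Equiv.Perm (Fin n), oddDiagram w = D ↔ (bruhatLE u w ∧ bruhatLE w v))
    (k : Fin n) (hk : u⁻¹ k ≠ v⁻¹ k) (hkmin : ∀ i : Fin n, i < k → u⁻¹ i = v⁻¹ i)
    (m : ℕ) (hm : 0 < m) (aseq : Fin m → Fin n) (hmono : StrictMono aseq)
    (hrange : ∀ i : Fin n, (∃ j : Fin m, aseq j = i) ↔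
      (u⁻¹ k ≤ i ∧ i ≤ v⁻¹ k ∧ u (u⁻¹ k) ≤ u i ∧ u i ≤ u (v⁻¹ k)))
    (vseq : Fin m → Equiv.Perm (Fin n))
    (hvseqm : vseq ⟨m - 1, Nat.sub_lt hm Nat.one_pos⟩ = v)
    (hvseqS : ∀ (i : ℕ) (h : i + 1 < m),
      vseq ⟨i, Nat.lt_of_succ_lt h⟩ = vseq ⟨i + 1, h⟩ *
        Equiv.swap (aseq ⟨i, Nat.lt_of_succ_lt h⟩) (aseq ⟨i + 1, h⟩)) :
    ∀ j : Fin m,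
      (bruhatLE u (vseq j) ∧ bruhatLE (vseq j) v ∧ (vseq j)⁻¹ k = aseq j) ∧
      ∀ w : Equiv.Perm (Fin n), bruhatLE u w → bruhatLE w v → w⁻¹ k = aseq j →
        bruhatLE w (vseq j) := by
  have huC := (hint u).1 hu
  have hvC := (hint v).1 hv
  have hPinv : ∀ w, oddDiagram w = D → ∀ i < k, w⁻¹ i = u⁻¹ i := by
    intro w hw i
    have hwC := (hint w).1 hw
    induction i using WellFoundedLT.induction with
    | _ i ih =>
      intro hi
      have ih' : ∀ j < i, w⁻¹ j = u⁻¹ j := fun j hj => ih j hj (hj.trans hi)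
      refine le_antisymm ?_ (inv_apply_le_of_bruhatLE hwC.1 fun j hj => (ih' j hj).symm)
      rw [hkmin i hi]
      exact inv_apply_le_of_bruhatLE hwC.2 fun j hj => (ih' j hj).trans (hkmin j (hj.trans hi))
  have hP : ∀ w, oddDiagram w = D → ∀ t, (w t < k ↔ u t < k) := by
    intro w hw t
    constructor <;> intro h
    · have := hPinv w hw _ h
      rw [perm_inv_apply_self, eq_comm, Equiv.Perm.inv_eq_iff_eq] at this
      rwa [← this]
    · have := hPinv w hw _ h
      rw [perm_inv_apply_self, Equiv.Perm.inv_eq_iff_eq] at this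
      rwa [← this]
  have hab : u⁻¹ k < v⁻¹ k := lt_of_le_of_ne (inv_apply_le_of_bruhatLE huC.2 hkmin) hk
  obtain ⟨a, ha⟩ : ∃ a, a = u⁻¹ k := ⟨_, rfl⟩
  obtain ⟨b, hb⟩ : ∃ b, b = v⁻¹ k := ⟨_, rfl⟩
  have hua : u a = k := by simp [ha]
  have hvb : v b = k := by simp [hb]
  rw [← ha, ← hb] at hrange hab
  rw [hua] at hrange
  have hDu : ∀ w, oddDiagram w = D → ∀ w', oddDiagram w' = D → ∀ i s, w s < w i → i < s →
      (i : ℕ) % 2 ≠ (s : ℕ) % 2 →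
      ∃ s', w' s' = w s ∧ w' s' < w' i ∧ i < s' ∧ (i : ℕ) % 2 ≠ (s' : ℕ) % 2 := by
    intro w hw w' hw' i s h1 h2 h3
    have hmem := (mem_oddDiagram_apply w i s).2 ⟨h1, h2, h3⟩
    rw [hw, ← hw'] at hmem
    obtain ⟨s', hs'⟩ := w'.surjective (w s)
    rw [← hs', mem_oddDiagram_apply] at hmem
    exact ⟨s', hs', hmem⟩
  have hparb : (b : ℕ) % 2 = (a : ℕ) % 2 := by
    by_contra hc
    have hva : v b < v a := by
      rw [hvb]
      refine lt_of_le_of_ne (not_lt.1 fun h => ?_) fun h => ?_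
      · rw [hP v hv, hua] at h
        exact lt_irrefl _ h
      · exact hab.ne (v.injective (h.symm.trans hvb.symm))
    obtain ⟨s, h1, h2, -⟩ := hDu v hv u hu a b hva hab (Ne.symm hc)
    rw [h1, hvb, hua] at h2
    exact lt_irrefl _ h2
  have hpar : ∀ t, a ≤ t → t ≤ b → k ≤ u t → (t : ℕ) % 2 = (a : ℕ) % 2 := by
    intro t hat htb hkt
    by_contra hc
    have htb' : t < b := lt_of_le_of_ne htb (by rintro rfl; exact hc hparb)
    have hvt : v b < v t := by
      rw [hvb]
      refine lt_of_le_of_ne (not_lt.1 fun h => ?_) fun h => ?_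
      · rw [hP v hv] at h
        exact absurd h (not_lt.2 hkt)
      · exact htb'.ne (v.injective (h.symm.trans hvb.symm))
    obtain ⟨s, h1, h2, h3, -⟩ := hDu v hv u hu t b hvt htb' (by omega)
    rw [hvb, ← hua] at h1
    rw [u.injective h1] at h3
    exact absurd hat (not_le.2 h3)
  have hlow : ∀ w, oddDiagram w = D → ∀ t, a ≤ t → t ≤ b → (t : ℕ) % 2 ≠ (a : ℕ) % 2 →
      w t < k := by
    intro w hw t h1 h2 h3
    rw [hP w hw]
    by_contra! hc
    exact h3 (hpar t h1 h2 hc)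
  have hub : k ≤ u b := not_lt.1 fun h => by
    rw [← hP v hv, hvb] at h
    exact lt_irrefl _ h
  -- values at odd distance to the right of `b` exceed those at positions in the sequence
  have hubO : ∀ s, b < s → (s : ℕ) % 2 ≠ (a : ℕ) % 2 → k ≤ u s → u b < u s := by
    intro s h1 h2 h3
    by_contra! hc
    have hlt : u s < u b := lt_of_le_of_ne hc fun h => h1.ne' (u.injective h)
    obtain ⟨s', g1, g2, -⟩ := hDu u hu v hv b s hlt h1 (by omega)
    rw [hvb, g1] at g2
    exact absurd h3 (not_le.2 g2)
  have hAO : ∀ w, oddDiagram w = D → ∀ t, a ≤ t → t ≤ b → k ≤ u t → u t ≤ u b →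
      ∀ s, b < s → (s : ℕ) % 2 ≠ (a : ℕ) % 2 → k ≤ w s → w t < w s := by
    intro w hw t h1 h2 h3 h4 s g1 g2 g3
    by_contra! hc
    have hts := lt_of_le_of_lt h2 g1
    have hlt : w s < w t := lt_of_le_of_ne hc fun h => hts.ne' (w.injective h)
    have hpt := hpar t h1 h2 h3
    obtain ⟨s', e1, e2, e3, e4⟩ := hDu w hw u hu t s hlt hts (by omega)
    rw [← e1] at g3
    rcases le_or_gt s' b with hs | hs
    · exact absurd (hlow u hu s' (h1.trans e3.le) hs (by omega)) (not_lt.2 g3)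
    · exact absurd (hubO s' hs (by omega) g3) (not_lt.2 (e2.le.trans h4))
  have hswap : ∀ w, oddDiagram w = D → ∀ p q, p < q → a ≤ p → q ≤ b → k ≤ u p → u p ≤ u b →
      k ≤ u q → u q ≤ u b → oddDiagram (w * Equiv.swap p q) = D := by
    intro w hw p q hpq hap hqb hkp hpb hkq hqb'
    have e1 := hpar p hap (hpq.le.trans hqb) hkp
    have e2 := hpar q (hap.trans hpq.le) hqb hkq
    have hwp : k ≤ w p := not_lt.1 fun h => absurd ((hP w hw p).1 h) (not_lt.2 hkp)
    have hwq : k ≤ w q := not_lt.1 fun h => absurd ((hP w hw q).1 h) (not_lt.2 hkq)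
    rw [oddDiagram_mul_swap w hpq (e1.trans e2.symm), hw]
    · intro t h1 h2 h3
      have := hlow w hw t (hap.trans h1.le) (h2.le.trans hqb) (by omega)
      exact ⟨this.trans_le hwp, this.trans_le hwq⟩
    · intro t h1 h2
      by_cases hkt : w t < k
      · exact iff_of_true (hkt.trans_le hwp) (hkt.trans_le hwq)
      have htb : b < t := by
        by_contra! hc
        exact hkt (hlow w hw t (hap.trans (hpq.le.trans h1.le)) hc (by omega))
      rw [not_lt] at hkt
      exact iff_of_false
        (hAO w hw p hap (hpq.le.trans hqb) hkp hpb t htb (by omega) hkt).not_gt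
        (hAO w hw q (hap.trans hpq.le) hqb hkq hqb' t htb (by omega) hkt).not_gt
  have hvanti : ∀ p q, p < q → a ≤ p → q ≤ b → k ≤ u p → u p ≤ u b →
      k ≤ u q → u q ≤ u b → v q < v p := by
    intro p q hpq h1 h2 h3 h4 h5 h6
    by_contra! hc
    have hlt : v p < v q := lt_of_le_of_ne hc fun h => hpq.ne (v.injective h)
    exact not_bruhatLE_of_swap hpq hlt
      ((hint _).1 (hswap v hv p q hpq h1 h2 h3 h4 h5 h6)).2
  have hvbig : ∀ t, a ≤ t → t ≤ b → u b < u t → ∀ p, a ≤ p → p ≤ b → k ≤ u p → u p ≤ u b →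
      v p < v t := by
    intro t h1 h2 h3 p g1 g2 g3 g4
    have htb : t < b := lt_of_le_of_ne h2 (by rintro rfl; exact lt_irrefl _ h3)
    have hpt := hpar t h1 h2 (hub.trans h3.le)
    obtain ⟨s, hbs, hs, hks, hst⟩ :
        ∃ s, b < s ∧ (s : ℕ) % 2 ≠ (a : ℕ) % 2 ∧ k ≤ u s ∧ u s < u t := by
      by_contra! hc
      have hD : oddDiagram (u * Equiv.swap t b) = D := by
        rw [oddDiagram_mul_swap u htb (hpt.trans hparb.symm), hu]
        · intro s e1 e2 e3
          have := (hlow u hu s (h1.trans e1.le) e2.le (by omega)).trans_le hub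
          exact ⟨this.trans h3, this⟩
        · intro s e1 e2
          by_cases hks : u s < k
          · exact iff_of_true ((hks.trans_le hub).trans h3) (hks.trans_le hub)
          have := hc s e1 (by omega) (not_lt.1 hks)
          exact iff_of_false this.not_gt (h3.trans_le this).not_gt
      have hle := ((hint _).1 hD).1
      refine not_bruhatLE_of_swap (x := u * Equiv.swap t b) htb (by simpa using h3) ?_
      rwa [mul_assoc, Equiv.swap_mul_self, mul_one]
    obtain ⟨s', e1, e2, e3, e4⟩ := hDu u hu v hv t s hst (htb.trans hbs) (by omega)
    rw [← e1] at hks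
    have hbs' : b < s' := by
      by_contra! hc
      exact absurd (hlow v hv s' (h1.trans e3.le) hc (by omega)) (not_lt.2 hks)
    exact (hAO v hv p g1 g2 g3 g4 s' hbs' (by omega) hks).trans e2
  have hmem : ∀ j, a ≤ aseq j ∧ aseq j ≤ b ∧ k ≤ u (aseq j) ∧ u (aseq j) ≤ u b :=
    fun j => (hrange _).1 ⟨j, rfl⟩
  have hlast : aseq ⟨m - 1, Nat.sub_lt hm Nat.one_pos⟩ = b := by
    obtain ⟨j, hj⟩ := (hrange b).2 ⟨hab.le, le_rfl, hub, le_rfl⟩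
    refine le_antisymm (hmem _).2.1 ?_
    rw [← hj]
    exact hmono.monotone (Fin.le_def.2 (Nat.le_sub_one_of_lt j.2))
  have main : ∀ d i : ℕ, ∀ hi : i < m, i + d = m - 1 →
      oddDiagram (vseq ⟨i, hi⟩) = D ∧ vseq ⟨i, hi⟩ (aseq ⟨i, hi⟩) = k ∧
      (∀ t < aseq ⟨i, hi⟩, vseq ⟨i, hi⟩ t = v t) ∧
      ∀ w, oddDiagram w = D → a ≤ w⁻¹ k → w⁻¹ k ≤ aseq ⟨i, hi⟩ →
        bruhatLE w (vseq ⟨i, hi⟩) := by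
    intro d
    induction d with
    | zero =>
      intro i hi hid
      obtain rfl : i = m - 1 := hid
      rw [hvseqm, hlast]
      exact ⟨hv, hvb, fun t _ => rfl, fun w hw _ _ => ((hint w).1 hw).2⟩
    | succ d ih =>
      intro i hi hid
      have hi' : i + 1 < m := by omega
      obtain ⟨hD, hxk, hxv, hxmax⟩ := ih (i + 1) hi' (by omega)
      rw [hvseqS i hi']
      obtain ⟨p1, p2, p3, p4⟩ := hmem ⟨i, hi⟩
      obtain ⟨q1, q2, q3, q4⟩ := hmem ⟨i + 1, hi'⟩
      have hpq : aseq ⟨i, hi⟩ < aseq ⟨i + 1, hi'⟩ :=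
        hmono (Fin.lt_def.2 (Nat.lt_succ_self i))
      have hnext : ∀ j, aseq j < aseq ⟨i + 1, hi'⟩ → aseq j ≤ aseq ⟨i, hi⟩ := fun j hj =>
        hmono.monotone (Fin.le_def.2 (Nat.le_of_lt_succ (Fin.lt_def.1 (hmono.lt_iff_lt.1 hj))))
      generalize aseq ⟨i, hi⟩ = p at *
      generalize aseq ⟨i + 1, hi'⟩ = q at *
      generalize vseq ⟨i + 1, hi'⟩ = x at *
      refine ⟨hswap x hD p q hpq p1 q2 p3 p4 q3 q4, by simp [hxk], fun t ht => ?_, ?_⟩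
      · rw [Equiv.Perm.mul_apply, Equiv.swap_apply_of_ne_of_ne ht.ne (ht.trans hpq).ne,
          hxv t (ht.trans hpq)]
      · intro w hw hwa hwp
        have hkp : k < x p := by
          refine lt_of_le_of_ne (not_lt.1 fun h => ?_) fun h => ?_
          · exact absurd ((hP x hD p).1 h) (not_lt.2 p3)
          · exact hpq.ne (x.injective (h.symm.trans hxk.symm))
        refine bruhatLE_mul_swap_of_bruhatLE (hxmax w hw hwa (hwp.trans hpq.le)) hpq hxk hkp hwp
          fun t h1 h2 => ?_
        rw [hxv t h2, hxv p hpq, hP w hw]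
        refine or_iff_not_imp_left.2 fun hkt => ?_
        rw [not_lt] at hkt
        have hat := hwa.trans h1
        have htb := h2.le.trans q2
        rcases le_or_gt (u t) (u b) with hA | hA
        · obtain ⟨j, rfl⟩ := (hrange t).2 ⟨hat, htb, hkt, hA⟩
          rcases lt_or_eq_of_le (hnext j h2) with h | h
          · exact (hvanti _ _ h hat p2 hkt hA p3 p4).le
          · rw [h]
        · exact (hvbig t hat htb hA p p1 p2 p3 p4).le
  intro j
  obtain ⟨hD, hxk, -, hmax⟩ := main (m - 1 - j) j j.2 (by omega)
  have hC := (hint _).1 hD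
  refine ⟨⟨hC.1, hC.2, by rw [Equiv.Perm.inv_eq_iff_eq]; exact hxk.symm⟩, fun w h1 h2 h3 => ?_⟩
  exact hmax w ((hint w).2 ⟨h1, h2⟩) (h3 ▸ (hmem j).1) h3.le
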